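/- Let τ, η ∈ ℂ with Re(τ) < 0 and set q = e^τ. For z ∈ ℂ let (z;q²)_∞ := ∏_{i=0}^∞ (1 − q^{2i} z). Define h(x) := e^{−2ηx/τ} · (1 − e^{2x}) · (q² e^{2(x−η)}; q²)_∞ / (e^{2(x+η)}; q²)_∞. Suppose q^{2i} e^{2(x+η)} ≠ 1 for all integers i ≥ 0. Then sinh(x)·sinh(x+τ−η)·h(x+τ) = sinh(x+τ)·sinh(x+η)·h(x). -/

import Mathlib

open Complex

/-- The q-shifted factorial `(z;q)_∞ := ∏_{i=0}^∞ (1 − qⁱ z)`. -/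
noncomputable def qpoch (z q : ℂ) : ℂ := ∏' i : ℕ, (1 - q ^ i * z)

/-- The two-point weight factor (wghtexplicit):
`h(x) = e^{−2ηx/τ}·(1−e^{2x})·(q² e^{2(x−η)}; q²)_∞ / (e^{2(x+η)}; q²)_∞`, with `q = e^τ`. -/
noncomputable def hweight (τ η x : ℂ) : ℂ :=
  Complex.exp (-(2 * η * x) / τ) * (1 - Complex.exp (2 * x))
    * qpoch (Complex.exp τ ^ 2 * Complex.exp (2 * (x - η))) (Complex.exp τ ^ 2)
    / qpoch (Complex.exp (2 * (x + η))) (Complex.exp τ ^ 2)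

theorem qpoch_step (z q : ℂ) (hq : ‖q‖ < 1) : qpoch z q = (1 - z) * qpoch (q * z) q := by
  have hm : Multipliable fun i : ℕ => (1 - q ^ i * (q * z)) := by
    have hs : Summable fun i : ℕ => ‖-(q ^ i * (q * z))‖ := by
      simp only [norm_neg, norm_mul, norm_pow]
      exact (summable_geometric_of_lt_one (norm_nonneg _) hq).mul_right _
    simpa [sub_eq_add_neg] using multipliable_one_add_of_summable hs
  unfold qpoch
  have e : ∀ i : ℕ, 1 - q ^ (i + 1) * z = 1 - q ^ i * (q * z) := fun i => by ring
  rw [tprod_eq_zero_mul' (f := fun i : ℕ => 1 - q ^ i * z) (by simpa only [e] using hm)]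
  simp only [e, pow_zero, one_mul]

/-- The functional equation
`h(x+τ) = [sinh(x+τ)sinh(x+η)/(sinh(x)sinh(x+τ−η))]·h(x)` for the explicit
two-point weight factor, in cleared-denominator form. -/
theorem hweight_functional_equation (τ η x : ℂ) (hτ : τ.re < 0)
    (hden : ∀ i : ℕ, Complex.exp τ ^ (2 * i) * Complex.exp (2 * (x + η)) ≠ 1) :
    sinh x * sinh (x + τ - η) * hweight τ η (x + τ)
      = sinh (x + τ) * sinh (x + η) * hweight τ η x := by
  have hτ0 : τ ≠ 0 := by rintro rfl; simp at hτ
  have hq : ‖Complex.exp τ ^ 2‖ < 1 := by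
    rw [norm_pow, Complex.norm_exp]
    exact pow_lt_one₀ (Real.exp_pos _).le (by simpa using hτ) two_ne_zero
  have h0 : 1 - Complex.exp (2 * (x + η)) ≠ 0 := by
    have := hden 0
    simp only [mul_zero, pow_zero, one_mul] at this
    exact sub_ne_zero.2 this.symm
  unfold hweight
  rw [qpoch_step (Complex.exp τ ^ 2 * Complex.exp (2 * (x - η))) _ hq,
    qpoch_step (Complex.exp (2 * (x + η))) _ hq]
  have e1 : Complex.exp (2 * (x + τ - η)) = Complex.exp τ ^ 2 * Complex.exp (2 * (x - η)) := by
    rw [← Complex.exp_nat_mul, ← Complex.exp_add]; congr 1; push_cast; ring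
  have e2 : Complex.exp (2 * (x + τ + η)) = Complex.exp τ ^ 2 * Complex.exp (2 * (x + η)) := by
    rw [← Complex.exp_nat_mul, ← Complex.exp_add]; congr 1; push_cast; ring
  have e3 : Complex.exp (-(2 * η * (x + τ)) / τ)
      = Complex.exp (-(2 * η * x) / τ) * Complex.exp (-(2 * η)) := by
    rw [← Complex.exp_add]; congr 1; field_simp; ring
  rw [e1, e2, e3]
  generalize qpoch (Complex.exp τ ^ 2 * (Complex.exp τ ^ 2 * Complex.exp (2 * (x - η)))) _ = P
  generalize qpoch (Complex.exp τ ^ 2 * Complex.exp (2 * (x + η))) _ = D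
  generalize Complex.exp (-(2 * η * x) / τ) = F
  have s : ∀ y : ℂ, sinh y = -(Complex.exp (-y) * (1 - Complex.exp (2 * y)) / 2) := fun y => by
    have : Complex.exp (-y) * Complex.exp (2 * y) = Complex.exp y := by
      rw [← Complex.exp_add]; congr 1; ring
    rw [Complex.sinh, mul_sub, this]; ring
  have e4 : Complex.exp (-x) * Complex.exp (-(x + τ - η)) * Complex.exp (-(2 * η))
      = Complex.exp (-(x + τ)) * Complex.exp (-(x + η)) := by
    simp only [← Complex.exp_add]; congr 1; ring
  rw [s, s, s, s, e1]
  generalize Complex.exp τ ^ 2 * Complex.exp (2 * (x - η)) = A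
  generalize Complex.exp (2 * (x + η)) = B at *
  generalize Complex.exp (2 * (x + τ)) = C
  generalize Complex.exp (2 * x) = X
  rw [div_eq_mul_inv _ D, div_eq_mul_inv _ ((1 - B) * D), mul_inv]
  have h1 : (1 - B) * (1 - B)⁻¹ = 1 := mul_inv_cancel₀ h0
  generalize (1 - B)⁻¹ = R at *
  linear_combination (1 - X) * (1 - A) * F * (1 - C) * P * D⁻¹ / 4 * e4
    - Complex.exp (-(x + τ)) * Complex.exp (-(x + η)) * (1 - X) * (1 - A) * F * (1 - C) * P * D⁻¹ / 4 * h1
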